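/- arXiv:2301.05643 — 2 statements merged into one kernel-verified Lean document; each statement's English description precedes it below -/
import Mathlib

section
/- Let n > 4 and let χ be an irreducible complex character of the symmetric group S_n with χ(1) > 1. Then there exists a positive integer e such that every irreducible character of S_n is a constituent of χ^e, and hence there is a smallest such positive integer. -/
open scoped ComplexOrder

noncomputable section

/-- `χ : G → ℂ` is the character of some finite-dimensional complex representation of `G`. -/
def IsChar (G : Type) [Group G] [Fintype G] (χ : G → ℂ) : Prop :=
  ∃ V : FDRep ℂ G, χ = V.character

/-- `χ : G → ℂ` is the character of some irreducible (simple) finite-dimensional complex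
representation of `G`. -/
def IsIrredChar (G : Type) [Group G] [Fintype G] (χ : G → ℂ) : Prop :=
  ∃ V : FDRep ℂ G, CategoryTheory.Simple V ∧ χ = V.character

/-- The usual inner product of class functions:
`⟨φ, ψ⟩ = |G|⁻¹ ∑ g, φ g * conj (ψ g)`. -/
def charInner (G : Type) [Group G] [Fintype G] (φ ψ : G → ℂ) : ℂ :=
  (Fintype.card G : ℂ)⁻¹ * ∑ g : G, φ g * (starRingEnd ℂ) (ψ g)

theorem multiset_sum_norm_eq (s : Multiset ℂ) :
    (∀ x ∈ s, ‖x‖ = 1) → ‖s.sum‖ = Multiset.card s →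
      ∀ x ∈ s, s.sum = (Multiset.card s : ℂ) * x := by
  induction s using Multiset.induction_on with
  | empty => simp
  | cons a s ih =>
    intro h1 h2
    have ha : ‖a‖ = 1 := h1 a (by simp)
    have hs : ∀ x ∈ s, ‖x‖ = 1 := fun x hx => h1 x (by simp [hx])
    have hle : ‖s.sum‖ ≤ Multiset.card s := by
      refine (norm_multiset_sum_le s).trans ?_
      rw [Multiset.map_congr rfl hs]
      simp
    simp only [Multiset.sum_cons, Multiset.card_cons, Nat.cast_add, Nat.cast_one] at h2 ⊢
    have htri := norm_add_le a s.sum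
    have hn : ‖s.sum‖ = Multiset.card s := by linarith
    have hray : SameRay ℝ a s.sum := by
      rw [sameRay_iff_norm_add, h2, ha, hn]; ring
    have h3 := hray.norm_smul_eq
    rw [ha, hn, one_smul, Complex.real_smul] at h3
    have h4 : s.sum = (Multiset.card s : ℂ) * a := by simpa using h3
    intro x hx
    rcases Multiset.mem_cons.mp hx with rfl | hx
    · rw [h4]; ring
    · have h5 := ih hs hn x hx
      have hc : (Multiset.card s : ℂ) ≠ 0 := by
        have : 0 < Multiset.card s := Multiset.card_pos_iff_exists_mem.mpr ⟨x, hx⟩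
        exact_mod_cast this.ne'
      have : x = a := mul_left_cancel₀ hc (h5.symm.trans h4)
      subst this
      rw [h4]; ring

section lin
variable {V : Type} [AddCommGroup V] [Module ℂ V] [FiniteDimensional ℂ V]

theorem root_norm_one (T : Module.End ℂ V) (m : ℕ) (hm : 0 < m) (hT : T ^ m = 1) :
    ∀ x ∈ T.charpoly.roots, ‖x‖ = 1 := by
  intro x hx
  have hx' := (Module.End.hasEigenvalue_iff_isRoot_charpoly T x).mpr (Polynomial.isRoot_of_mem_roots hx)
  obtain ⟨v, hv⟩ := hx'.exists_hasEigenvector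
  have h1 := hv.pow_apply m
  rw [hT] at h1
  have h2 : (x ^ m - 1) • v = 0 := by
    rw [sub_smul, ← h1]; simp
  have h3 : x ^ m = 1 := by
    rcases smul_eq_zero.mp h2 with h | h
    · exact sub_eq_zero.mp h
    · exact absurd h hv.2
  exact Complex.norm_eq_one_of_pow_eq_one h3 hm.ne'

theorem card_roots_charpoly (T : Module.End ℂ V) :
    Multiset.card T.charpoly.roots = Module.finrank ℂ V := by
  rw [← (IsAlgClosed.splits T.charpoly).natDegree_eq_card_roots, LinearMap.charpoly_natDegree]

theorem norm_trace_le (T : Module.End ℂ V) (m : ℕ) (hm : 0 < m) (hT : T ^ m = 1) :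
    ‖LinearMap.trace ℂ V T‖ ≤ Module.finrank ℂ V := by
  rw [Module.End.trace_eq_sum_roots_charpoly_of_splits (IsAlgClosed.splits _)]
  refine (norm_multiset_sum_le _).trans ?_
  rw [Multiset.map_congr rfl (root_norm_one T m hm hT)]
  simp [card_roots_charpoly]

theorem scalar_of_norm_trace (T : Module.End ℂ V) (m : ℕ) (hm : 0 < m) (hT : T ^ m = 1)
    (hd : 0 < Module.finrank ℂ V)
    (h : ‖LinearMap.trace ℂ V T‖ = Module.finrank ℂ V) : ∃ c : ℂ, T = c • 1 := by
  have hr := root_norm_one T m hm hT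
  have hs := IsAlgClosed.splits T.charpoly
  rw [Module.End.trace_eq_sum_roots_charpoly_of_splits hs, ← card_roots_charpoly T] at h
  have key := multiset_sum_norm_eq _ hr h
  rw [← card_roots_charpoly T] at hd
  obtain ⟨c, hc⟩ := Multiset.card_pos_iff_exists_mem.mp hd
  have hc0 : (Multiset.card T.charpoly.roots : ℂ) ≠ 0 := by exact_mod_cast hd.ne'
  have hall : ∀ x ∈ T.charpoly.roots, x = c := fun x hx =>
    mul_left_cancel₀ hc0 ((key x hx).symm.trans (key c hc))
  have hrep := Multiset.eq_replicate.mpr ⟨rfl, hall⟩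
  have hchar : T.charpoly = (Polynomial.X - Polynomial.C c) ^ Multiset.card T.charpoly.roots := by
    conv_lhs => rw [hs.eq_prod_roots_of_monic (LinearMap.charpoly_monic T), hrep]
    simp
  have hnil : IsNilpotent (T - algebraMap ℂ (Module.End ℂ V) c) := by
    refine ⟨Multiset.card T.charpoly.roots, ?_⟩
    have := LinearMap.aeval_self_charpoly T
    rw [hchar] at this
    simpa using this
  have hss : T.IsSemisimple := by
    apply Module.End.isSemisimple_of_squarefree_aeval_eq_zero
      (p := Polynomial.X ^ m - Polynomial.C 1)
    · exact (Polynomial.separable_X_pow_sub_C 1 (by exact_mod_cast hm.ne') one_ne_zero).squarefree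
    · simp [hT]
  have := Module.End.eq_zero_of_isNilpotent_isSemisimple hnil
    (Module.End.isSemisimple_sub_algebraMap_iff.mpr hss)
  refine ⟨c, ?_⟩
  rw [sub_eq_zero.mp this, Algebra.algebraMap_eq_smul_one]

end lin

section rep
variable {G : Type} [Group G] [Fintype G]

theorem rho_pow_card (V : FDRep ℂ G) (g : G) : V.ρ g ^ Fintype.card G = 1 := by
  rw [← map_pow, pow_card_eq_one, map_one]

theorem norm_char_le (V : FDRep ℂ G) (g : G) : ‖V.character g‖ ≤ Module.finrank ℂ V :=
  norm_trace_le (V.ρ g) _ Fintype.card_pos (rho_pow_card V g)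

theorem simple_hom_finrank (V : FDRep ℂ G) [CategoryTheory.Simple V] :
    Module.finrank ℂ (V ⟶ V) = 1 := by
  classical
  rw [FDRep.finrank_hom_simple_simple, if_pos ⟨CategoryTheory.Iso.refl V⟩]

theorem finrank_pos_of_simple (V : FDRep ℂ G) [CategoryTheory.Simple V] :
    0 < Module.finrank ℂ V := by
  rw [Nat.pos_iff_ne_zero]
  intro h0
  have h1 := simple_hom_finrank V
  rw [← (Representation.linHom.invariantsEquivFDRepHom V V).finrank_eq] at h1
  have : Subsingleton V := Module.finrank_zero_iff.mp h0
  have : Subsingleton (V →ₗ[ℂ] V) := inferInstance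
  have : Module.finrank ℂ (Representation.linHom V.ρ V.ρ).invariants = 0 :=
    Module.finrank_zero_of_subsingleton
  omega

/-- If the image of a simple representation is commutative, its degree is one. -/
theorem finrank_one_of_comm (V : FDRep ℂ G) [CategoryTheory.Simple V]
    (hcomm : ∀ g h : G, V.ρ (g * h) = V.ρ (h * g)) : Module.finrank ℂ V = 1 := by
  have hpos := finrank_pos_of_simple V
  have : Nontrivial V := Module.finrank_pos_iff.mp hpos
  have h1 := simple_hom_finrank V
  rw [← (Representation.linHom.invariantsEquivFDRepHom V V).finrank_eq] at h1
  have hmem : ∀ T : V →ₗ[ℂ] V, (∀ g, V.ρ g ∘ₗ T = T ∘ₗ V.ρ g) →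
      T ∈ (Representation.linHom V.ρ V.ρ).invariants := by
    intro T hT g
    rw [Representation.linHom_apply, ← LinearMap.comp_assoc, hT, LinearMap.comp_assoc,
      ← Module.End.mul_eq_comp (V.ρ g), ← map_mul]
    ext; simp
  let I : (Representation.linHom V.ρ V.ρ).invariants := ⟨1, hmem 1 (fun g => by ext; simp)⟩
  have hI : I ≠ 0 := by
    intro h
    have := congrArg Subtype.val h
    exact one_ne_zero this
  have hsc : ∀ g, ∃ c : ℂ, V.ρ g = c • 1 := by
    intro g
    obtain ⟨c, hc⟩ := (finrank_eq_one_iff_of_nonzero' I hI).mp h1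
      ⟨V.ρ g, hmem _ (fun h => by
        rw [← Module.End.mul_eq_comp, ← Module.End.mul_eq_comp, ← map_mul, ← map_mul, hcomm])⟩
    exact ⟨c, (congrArg Subtype.val hc).symm⟩
  have : Invertible (Nat.card G : ℂ) := invertibleOfNonzero (by simp [Nat.card_eq_fintype_card])
  classical
  have horth := FDRep.char_orthonormal V V
  rw [if_pos ⟨CategoryTheory.Iso.refl V⟩] at horth
  have hterm : ∀ g : G, V.character g * V.character g⁻¹ = (Module.finrank ℂ V : ℂ) ^ 2 := by
    intro g
    obtain ⟨c, hc⟩ := hsc g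
    obtain ⟨d, hd⟩ := hsc g⁻¹
    have hcd : (c * d) • (1 : Module.End ℂ V) = 1 := by
      have : V.ρ g * V.ρ g⁻¹ = 1 := by rw [← map_mul]; simp
      rw [hc, hd] at this
      simpa [smul_smul, mul_comm] using this
    have hcd' := congrArg (LinearMap.trace ℂ V) hcd
    rw [map_smul, LinearMap.trace_one, smul_eq_mul] at hcd'
    rw [FDRep.character, FDRep.character, hc, hd, map_smul, map_smul, LinearMap.trace_one,
      smul_eq_mul, smul_eq_mul]
    linear_combination (Module.finrank ℂ V : ℂ) * hcd'
  rw [Finset.sum_congr rfl (fun g _ => hterm g)] at horth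
  have hG : (Nat.card G : ℂ) ≠ 0 := by simp [Nat.card_eq_fintype_card]
  simp only [Finset.sum_const, Finset.card_univ, ← Nat.card_eq_fintype_card, nsmul_eq_mul] at horth
  rw [inv_mul_cancel_left₀ hG] at horth
  have h2 : Module.finrank ℂ V ^ 2 = 1 := by exact_mod_cast horth
  simpa using h2

/-- The subgroup of elements acting as scalars. -/
def scalarSub (V : FDRep ℂ G) : Subgroup G where
  carrier := {g | ∃ c : ℂ, V.ρ g = c • 1}
  one_mem' := ⟨1, by simp⟩
  mul_mem' := by
    rintro a b ⟨c, hc⟩ ⟨d, hd⟩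
    exact ⟨c * d, by rw [map_mul, hc, hd]; simp [smul_smul, mul_comm]⟩
  inv_mem' := by
    rintro a ⟨c, hc⟩
    have h1 : V.ρ a * V.ρ a⁻¹ = 1 := by rw [← map_mul]; simp
    rw [hc, smul_mul_assoc, one_mul] at h1
    by_cases h0 : c = 0
    · subst h0
      rw [zero_smul] at h1
      exact ⟨1, by rw [← mul_one (V.ρ a⁻¹), ← h1]; simp⟩
    · exact ⟨c⁻¹, by rw [← h1, smul_smul, inv_mul_cancel₀ h0, one_smul]⟩

instance scalarSub_normal (V : FDRep ℂ G) : (scalarSub V).Normal := by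
  constructor
  rintro a ⟨c, hc⟩ g
  refine ⟨c, ?_⟩
  have h1 : V.ρ g * V.ρ g⁻¹ = 1 := by rw [← map_mul]; simp
  rw [map_mul, map_mul, hc, mul_smul_comm, mul_one, smul_mul_assoc, h1]

end rep

theorem norm_char_lt (n : ℕ) (hn : 4 < n) (V : FDRep ℂ (Equiv.Perm (Fin n)))
    [CategoryTheory.Simple V] (hd : 1 < Module.finrank ℂ V) (g : Equiv.Perm (Fin n))
    (hg : g ≠ 1) : ‖V.character g‖ < Module.finrank ℂ V := by
  refine lt_of_le_of_ne (norm_char_le V g) fun heq => ?_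
  have hsc := scalar_of_norm_trace (V.ρ g) _ Fintype.card_pos (rho_pow_card V g) (by omega) heq
  have h5 : 5 ≤ Nat.card (Fin n) := by simp only [Nat.card_eq_fintype_card, Fintype.card_fin]; omega
  have hle : alternatingGroup (Fin n) ≤ scalarSub V := by
    apply Equiv.Perm.alternatingGroup_le_of_normal h5
    exact ⟨⟨⟨g, hsc⟩, 1, fun h => hg (congrArg Subtype.val h)⟩⟩
  let K : Subgroup (Equiv.Perm (Fin n)) := MonoidHom.ker V.ρ
  have hK : alternatingGroup (Fin n) ≤ K := by
    rw [← commutator_alternatingGroup_eq_self h5, Subgroup.commutator_le]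
    intro a ha b hb
    obtain ⟨c, hc⟩ := hle ha
    obtain ⟨d, hd⟩ := hle hb
    change V.ρ (a * b * a⁻¹ * b⁻¹) = 1
    have hab : V.ρ a * V.ρ b = V.ρ b * V.ρ a := by
      rw [hc, hd]; simp [smul_smul, mul_comm]
    rw [map_mul, map_mul, map_mul, hab, ← map_mul, ← map_mul, ← map_mul]
    simp
  have := finrank_one_of_comm V (fun a b => by
    have h1 : (a * b * a⁻¹ * b⁻¹) ∈ K := hK (by
      rw [← alternatingGroup.commutator_perm_eq h5]
      exact Subgroup.commutator_mem_commutator (Subgroup.mem_top _) (Subgroup.mem_top _))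
    have h2 : a * b = (a * b * a⁻¹ * b⁻¹) * (b * a) := by group
    have h3 : V.ρ (a * b * a⁻¹ * b⁻¹) = 1 := h1
    rw [h2, map_mul, h3, one_mul])
  omega

theorem exists_covering (n : ℕ) (hn : 4 < n)
    (χ : Equiv.Perm (Fin n) → ℂ) (hχ : IsIrredChar (Equiv.Perm (Fin n)) χ) (hd : 1 < χ 1) :
    ∃ e : ℕ, 0 < e ∧
        ∀ θ : Equiv.Perm (Fin n) → ℂ, IsIrredChar (Equiv.Perm (Fin n)) θ →
          charInner (Equiv.Perm (Fin n)) (χ ^ e) θ ≠ 0 := by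
  obtain ⟨V, hV, rfl⟩ := hχ
  rw [FDRep.char_one] at hd
  have hd' : 1 < Module.finrank ℂ V := by exact_mod_cast hd
  set d := Module.finrank ℂ V with hdd
  have hd0 : (0 : ℝ) < d := by exact_mod_cast (by omega : 0 < d)
  let S := (Finset.univ : Finset (Equiv.Perm (Fin n))).erase 1
  have hlim : Filter.Tendsto (fun e : ℕ => ∑ g ∈ S, (‖V.character g‖ / d) ^ e) Filter.atTop
      (nhds (∑ g ∈ S, 0)) := by
    apply tendsto_finsetSum
    intro g hg
    apply tendsto_pow_atTop_nhds_zero_of_lt_one (by positivity)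
    rw [div_lt_one hd0]
    exact norm_char_lt n hn V hd' g (Finset.ne_of_mem_erase hg)
  rw [Finset.sum_const_zero] at hlim
  obtain ⟨e, he1, he0⟩ := ((hlim.eventually (gt_mem_nhds one_pos)).and
    (Filter.eventually_gt_atTop 0)).exists
  refine ⟨e, he0, ?_⟩
  rintro θ ⟨W, hW, rfl⟩ hzero
  have hw : (0 : ℝ) < Module.finrank ℂ W := by exact_mod_cast finrank_pos_of_simple W
  have hsum : ∑ g ∈ S, ‖V.character g‖ ^ e < (d : ℝ) ^ e := by
    simp only [div_pow] at he1
    rw [← Finset.sum_div, div_lt_one (by positivity)] at he1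
    exact he1
  unfold charInner at hzero
  rcases mul_eq_zero.mp hzero with h | h
  · simp [Fintype.card_ne_zero] at h
  rw [← Finset.add_sum_erase _ _ (Finset.mem_univ 1)] at h
  have h2 : ‖(V.character ^ e) 1 * (starRingEnd ℂ) (W.character 1)‖
      = (d : ℝ) ^ e * Module.finrank ℂ W := by
    simp [hdd]
  rw [eq_neg_of_add_eq_zero_left h, norm_neg] at h2
  have h3 : ‖∑ g ∈ S, (V.character ^ e) g * (starRingEnd ℂ) (W.character g)‖
      ≤ (∑ g ∈ S, ‖V.character g‖ ^ e) * Module.finrank ℂ W := by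
    refine (norm_sum_le _ _).trans ?_
    rw [Finset.sum_mul]
    refine Finset.sum_le_sum fun g _ => ?_
    rw [norm_mul, Pi.pow_apply, norm_pow, RCLike.norm_conj]
    exact mul_le_mul_of_nonneg_left (norm_char_le W g) (by positivity)
  have h4 := mul_lt_mul_of_pos_right hsum hw
  exact absurd (h3.trans_lt h4) (by rw [← h2]; exact lt_irrefl _)

/-- For `n > 4` and an irreducible character `χ` of `S_n` with `χ(1) > 1`, there is a
positive integer `e` with `c(χ^e) = Irr(S_n)`, and hence a smallest such. -/
theorem exists_smallest_covering_exponent (n : ℕ) (hn : 4 < n)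
    (χ : Equiv.Perm (Fin n) → ℂ) (hχ : IsIrredChar (Equiv.Perm (Fin n)) χ) (hd : 1 < χ 1) :
    (∃ e : ℕ, 0 < e ∧
        ∀ θ : Equiv.Perm (Fin n) → ℂ, IsIrredChar (Equiv.Perm (Fin n)) θ →
          charInner (Equiv.Perm (Fin n)) (χ ^ e) θ ≠ 0) ∧
      ∃ e : ℕ, (0 < e ∧
          ∀ θ : Equiv.Perm (Fin n) → ℂ, IsIrredChar (Equiv.Perm (Fin n)) θ →
            charInner (Equiv.Perm (Fin n)) (χ ^ e) θ ≠ 0) ∧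
        ∀ e' : ℕ, (0 < e' ∧
            ∀ θ : Equiv.Perm (Fin n) → ℂ, IsIrredChar (Equiv.Perm (Fin n)) θ →
              charInner (Equiv.Perm (Fin n)) (χ ^ e') θ ≠ 0) → e ≤ e' := by
  classical
  have h := exists_covering n hn χ hχ hd
  exact ⟨h, Nat.find h, Nat.find_spec h, fun e' he' => Nat.find_min' h he'⟩
end
end

section
/- Let G be the dihedral group with 14 elements and let χ be any irreducible complex character of G with χ(1) > 1. Then: (a) every irreducible character of G is a constituent of χ^6, but not every irreducible character of G is a constituent of χ^5; and (b) every irreducible character of G is a constituent of some power χ^j with 1 ≤ j ≤ 3, but not every irreducible character of G is a constituent of some power χ^j with 1 ≤ j ≤ 2. -/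
open scoped ComplexOrder

noncomputable section

open DihedralGroup

/-- Algebraic relations between the three periods. -/
structure PRel (a b c : ℂ) : Prop where
  aa : a ^ 2 = 2 + b
  bb : b ^ 2 = 2 + c
  cc : c ^ 2 = 2 + a
  ab : a * b = a + c
  ac : a * c = b + c
  bc : b * c = a + b
  s : a + b + c = -1
  ra : (starRingEnd ℂ) a = a
  rb : (starRingEnd ℂ) b = b
  rc : (starRingEnd ℂ) c = c

theorem PRel.rot {a b c : ℂ} (h : PRel a b c) : PRel b c a := by
  obtain ⟨h1, h2, h3, h4, h5, h6, h7, h8, h9, h10⟩ := h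
  constructor <;> first | assumption | grind

/-- Two-dimensional characters. -/
def F (a b c : ℂ) : DihedralGroup 7 → ℂ
  | r i => (![2, a, b, c, c, b, a] : Fin 7 → ℂ) i
  | sr _ => 0

/-- One-dimensional characters. -/
def E (s : ℂ) : DihedralGroup 7 → ℂ
  | r _ => 1
  | sr _ => s

theorem sum_dih (f : DihedralGroup 7 → ℂ) :
    ∑ g, f g = (f (r 0) + f (r 1) + f (r 2) + f (r 3) + f (r 4) + f (r 5) + f (r 6)) +
      (f (sr 0) + f (sr 1) + f (sr 2) + f (sr 3) + f (sr 4) + f (sr 5) + f (sr 6)) := by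
  rw [← Equiv.sum_comp (DihedralGroup.equivSum (n := 7)).symm, Fintype.sum_sum_type]
  congr 1
  · exact Fin.sum_univ_seven (fun i : Fin 7 => f (r i))
  · exact Fin.sum_univ_seven (fun i : Fin 7 => f (sr i))

section F
variable (a b c : ℂ)
theorem F0 : F a b c (r 0) = 2 := rfl
theorem F1 : F a b c (r 1) = a := rfl
theorem F2 : F a b c (r 2) = b := rfl
theorem F3 : F a b c (r 3) = c := rfl
theorem F4 : F a b c (r 4) = c := rfl
theorem F5 : F a b c (r 5) = b := rfl
theorem F6 : F a b c (r 6) = a := rfl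
theorem Fs (i) : F a b c (sr i) = 0 := rfl
theorem Er (i) : E a (r i) = 1 := rfl
theorem Es (i) : E a (sr i) = a := rfl
end F

theorem F_inv (a b c : ℂ) (g) : F a b c g⁻¹ = F a b c g := by
  rcases g with i | i
  · rw [inv_r]
    fin_cases i <;> rfl
  · rw [inv_sr]

theorem E_inv (s : ℂ) (g) : E s g⁻¹ = E s g := by
  rcases g with i | i
  · rw [inv_r]; rfl
  · rw [inv_sr]

theorem irr_of_norm (ψ : DihedralGroup 7 → ℂ) (hi : ∀ g, ψ g⁻¹ = ψ g)
    (V : FDRep ℂ (DihedralGroup 7)) (hV : V.character = ψ) (hn : ∑ g, ψ g * ψ g = 14) :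
    IsIrredChar (DihedralGroup 7) ψ := by
  refine ⟨V, ?_, hV.symm⟩
  rw [FDRep.simple_iff_char_is_norm_one, hV, DihedralGroup.nat_card]
  simp only [hi, hn]
  norm_num

theorem E_irr (s : ℂ) (hs : s * s = 1) : IsIrredChar (DihedralGroup 7) (E s) := by
  let m : DihedralGroup 7 →* (ℂ →ₗ[ℂ] ℂ) :=
    { toFun := fun g => E s g • LinearMap.id
      map_one' := by
        rw [one_def, Er, one_smul]; rfl
      map_mul' := by
        rintro (i | i) (j | j) <;> ext <;> simp [Er, Es, hs] }
  refine irr_of_norm _ (E_inv s) (FDRep.of m) ?_ ?_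
  · ext g
    change LinearMap.trace ℂ ℂ (E s g • LinearMap.id) = _
    simp
  · rw [sum_dih]
    simp only [Er, Es, hs]
    norm_num

/-- Matrices of the two-dimensional representations. -/
def M (e : AddChar (ZMod 7) ℂ) : DihedralGroup 7 → Matrix (Fin 2) (Fin 2) ℂ
  | r i => !![e i, 0; 0, e (-i)]
  | sr i => !![0, e (-i); e i, 0]

theorem periods (z : ℂ) (h7 : z ^ 7 = 1) (h1 : z ≠ 1) :
    PRel (z + z ^ 6) (z ^ 2 + z ^ 5) (z ^ 3 + z ^ 4) := by
  have hs : 1 + z + z ^ 2 + z ^ 3 + z ^ 4 + z ^ 5 + z ^ 6 = 0 := by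
    have : (z - 1) * (1 + z + z ^ 2 + z ^ 3 + z ^ 4 + z ^ 5 + z ^ 6) = 0 := by
      linear_combination h7
    exact (mul_eq_zero.mp this).resolve_left (sub_ne_zero.mpr h1)
  have hc : (starRingEnd ℂ) z = z ^ 6 := by
    have hz : ‖z‖ = 1 := Complex.norm_eq_one_of_pow_eq_one h7 (by norm_num)
    rw [← Complex.inv_eq_conj hz]
    have : z ≠ 0 := by rintro rfl; norm_num at h7
    field_simp
    linear_combination -h7
  constructor
  · grind
  · grind
  · grind
  · grind
  · grind
  · grind
  · grind
  all_goals
    simp only [map_add, map_pow, hc]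
    grind

theorem F_norm {a b c : ℂ} (h : PRel a b c) : ∑ g, F a b c g * F a b c g = 14 := by
  rw [sum_dih]
  simp only [F0, F1, F2, F3, F4, F5, F6, Fs]
  linear_combination 2 * h.aa + 2 * h.bb + 2 * h.cc + 2 * h.s

theorem F_irr (z : ℂ) (h7 : z ^ 7 = 1) (h1 : z ≠ 1) :
    IsIrredChar (DihedralGroup 7) (F (z + z ^ 6) (z ^ 2 + z ^ 5) (z ^ 3 + z ^ 4)) := by
  let e : AddChar (ZMod 7) ℂ := AddChar.zmodChar 7 h7
  let m : DihedralGroup 7 →* Matrix (Fin 2) (Fin 2) ℂ :=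
    { toFun := M e
      map_one' := by
        rw [one_def]
        ext i j
        fin_cases i <;> fin_cases j <;> simp [M]
      map_mul' := by
        rintro (i | i) (j | j) <;> ext k l <;> fin_cases k <;> fin_cases l <;>
          simp [M, Matrix.mul_apply, ← AddChar.map_add_eq_mul] <;> congr 1 <;> ring }
  let ρ : DihedralGroup 7 →* ((Fin 2 → ℂ) →ₗ[ℂ] (Fin 2 → ℂ)) :=
    (Matrix.toLinAlgEquiv' : Matrix (Fin 2) (Fin 2) ℂ ≃ₐ[ℂ] _).toAlgHom.toMonoidHom.comp m
  refine irr_of_norm _ (F_inv _ _ _) (FDRep.of ρ) ?_ (F_norm (periods z h7 h1))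
  ext g
  change LinearMap.trace ℂ (Fin 2 → ℂ) (Matrix.toLin' (M e g)) = _
  rw [Matrix.trace_toLin'_eq]
  have he : ∀ i : ZMod 7, e i = z ^ i.val := AddChar.zmodChar_apply h7
  rcases g with i | i
  · have : Matrix.trace (M e (r i)) = z ^ i.val + z ^ (-i).val := by
      simp [M, Matrix.trace, he]
    rw [this]
    fin_cases i
    · change z ^ 0 + z ^ 0 = 2
      norm_num
    · change z ^ 1 + z ^ 6 = z + z ^ 6
      ring
    · change z ^ 2 + z ^ 5 = z ^ 2 + z ^ 5
      ring
    · change z ^ 3 + z ^ 4 = z ^ 3 + z ^ 4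
      ring
    · change z ^ 4 + z ^ 3 = z ^ 3 + z ^ 4
      ring
    · change z ^ 5 + z ^ 2 = z ^ 2 + z ^ 5
      ring
    · change z ^ 6 + z ^ 1 = z + z ^ 6
      ring
  · simp [M, Matrix.trace, Fs]

theorem orth (θ ψ : DihedralGroup 7 → ℂ) (hθ : IsIrredChar (DihedralGroup 7) θ)
    (hψ : IsIrredChar (DihedralGroup 7) ψ) (hi : ∀ g, ψ g⁻¹ = ψ g) (hne : θ ≠ ψ) :
    ∑ g, θ g * ψ g = 0 := by
  obtain ⟨V, hV, rfl⟩ := hθ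
  obtain ⟨W, hW, rfl⟩ := hψ
  have : Invertible (Nat.card (DihedralGroup 7) : ℂ) :=
    invertibleOfNonzero (by rw [DihedralGroup.nat_card]; norm_num)
  have h := FDRep.char_orthonormal V W
  have hn : ¬ Nonempty (V ≅ W) := fun ⟨i⟩ => hne (FDRep.char_iso i)
  rw [if_neg hn, DihedralGroup.nat_card] at h
  simp only [hi] at h
  simpa using h

theorem irr_one_ne (θ : DihedralGroup 7 → ℂ) (hθ : IsIrredChar (DihedralGroup 7) θ) :
    θ (r 0) ≠ 0 := by
  obtain ⟨V, hV, rfl⟩ := hθ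
  intro h0
  change V.character 1 = 0 at h0
  rw [FDRep.char_one] at h0
  have h1 := (FDRep.simple_iff_char_is_norm_one V).mp hV
  have hf : Module.finrank ℂ V = 0 := by exact_mod_cast h0
  have : ∀ g, V.character g = 0 := by
    intro g
    have : Subsingleton V := Module.finrank_zero_iff.mp hf
    have hz : V.ρ g = 0 := by
      ext x; exact Subsingleton.elim _ _
    change LinearMap.trace ℂ V (V.ρ g) = 0
    rw [hz, map_zero]
  simp only [this] at h1
  rw [DihedralGroup.nat_card] at h1
  norm_num at h1

theorem exists_abc : ∃ a b c : ℂ, PRel a b c ∧ IsIrredChar (DihedralGroup 7) (F a b c) ∧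
    IsIrredChar (DihedralGroup 7) (F b c a) ∧ IsIrredChar (DihedralGroup 7) (F c a b) := by
  have hp := Complex.isPrimitiveRoot_exp 7 (by norm_num)
  set z := Complex.exp (2 * Real.pi * Complex.I / (7 : ℕ))
  have h7 : z ^ 7 = 1 := hp.pow_eq_one
  refine ⟨_, _, _, periods z h7 (hp.ne_one (by norm_num)), F_irr z h7 (hp.ne_one (by norm_num)),
    ?_, ?_⟩
  · convert F_irr (z ^ 2) (by grind) (hp.pow_ne_one_of_pos_of_lt (by norm_num) (by norm_num))
      using 2 <;> grind
  · convert F_irr (z ^ 3) (by grind) (hp.pow_ne_one_of_pos_of_lt (by norm_num) (by norm_num))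
      using 2 <;> grind

theorem classify {a b c : ℂ} (h : PRel a b c) (h1 : IsIrredChar (DihedralGroup 7) (F a b c))
    (h2 : IsIrredChar (DihedralGroup 7) (F b c a)) (h3 : IsIrredChar (DihedralGroup 7) (F c a b))
    (θ : DihedralGroup 7 → ℂ) (hθ : IsIrredChar (DihedralGroup 7) θ) :
    θ = E 1 ∨ θ = E (-1) ∨ θ = F a b c ∨ θ = F b c a ∨ θ = F c a b := by
  by_contra! hn
  obtain ⟨n1, n2, n3, n4, n5⟩ := hn
  have e1 := orth θ _ hθ (E_irr 1 (by norm_num)) (E_inv _) n1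
  have e2 := orth θ _ hθ (E_irr (-1) (by norm_num)) (E_inv _) n2
  have e3 := orth θ _ hθ h1 (F_inv _ _ _) n3
  have e4 := orth θ _ hθ h2 (F_inv _ _ _) n4
  have e5 := orth θ _ hθ h3 (F_inv _ _ _) n5
  rw [sum_dih] at e1 e2 e3 e4 e5
  simp only [F0, F1, F2, F3, F4, F5, F6, Fs, Er, Es] at e1 e2 e3 e4 e5
  apply irr_one_ne θ hθ
  have hs := h.s
  linear_combination (1 / 14) * e1 + (1 / 14) * e2 + (1 / 7) * e3 + (1 / 7) * e4 + (1 / 7) * e5 -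
    (1 / 7) * hs * (θ (r 1) + θ (r 2) + θ (r 3) + θ (r 4) + θ (r 5) + θ (r 6))

theorem inner_E (χ : DihedralGroup 7 → ℂ) (a b c s : ℂ) (j : ℕ) (hj : j ≠ 0)
    (hχ : χ = F a b c) : charInner (DihedralGroup 7) (χ ^ j) (E s) =
      14⁻¹ * (2 ^ j + 2 * a ^ j + 2 * b ^ j + 2 * c ^ j) := by
  subst hχ
  rw [charInner, DihedralGroup.card, sum_dih]
  simp only [F0, F1, F2, F3, F4, F5, F6, Fs, Er, Es, Pi.pow_apply, map_one, zero_pow hj]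
  push_cast
  ring

theorem inner_F (a b c x y z : ℂ) (h : PRel x y z) (j : ℕ) :
    charInner (DihedralGroup 7) (F a b c ^ j) (F x y z) =
      14⁻¹ * (2 * 2 ^ j + 2 * a ^ j * x + 2 * b ^ j * y + 2 * c ^ j * z) := by
  rw [charInner, DihedralGroup.card, sum_dih]
  simp only [F0, F1, F2, F3, F4, F5, F6, Fs, Pi.pow_apply, map_zero, h.ra, h.rb, h.rc,
    Complex.conj_ofNat]
  push_cast
  ring

theorem pow_rel {a b c : ℂ} (h : PRel a b c) :
    a ^ 3 = 3 * a + c ∧ a ^ 5 = 10 * a + b + 5 * c ∧ a ^ 6 = 20 + a + 15 * b + 6 * c := by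
  obtain ⟨h1, h2, h3, h4, h5, h6, h7, h8, h9, h10⟩ := h
  have k3 : a ^ 3 = 3 * a + c := by linear_combination a * h1 + h4
  have k4 : a ^ 4 = 6 + 4 * b + c := by linear_combination a * k3 + 3 * h1 + h5
  have k5 : a ^ 5 = 10 * a + b + 5 * c := by linear_combination a * k4 + 4 * h4 + h5
  exact ⟨k3, k5, by linear_combination a * k5 + 10 * h1 + h4 + 5 * h5⟩

theorem main_aux {a b c : ℂ} (h : PRel a b c) (h1 : IsIrredChar (DihedralGroup 7) (F a b c))
    (h2 : IsIrredChar (DihedralGroup 7) (F b c a)) (h3 : IsIrredChar (DihedralGroup 7) (F c a b)) :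
    ((∀ θ : DihedralGroup 7 → ℂ, IsIrredChar (DihedralGroup 7) θ →
        charInner (DihedralGroup 7) (F a b c ^ 6) θ ≠ 0) ∧
      ¬ (∀ θ : DihedralGroup 7 → ℂ, IsIrredChar (DihedralGroup 7) θ →
        charInner (DihedralGroup 7) (F a b c ^ 5) θ ≠ 0)) ∧
    ((∀ θ : DihedralGroup 7 → ℂ, IsIrredChar (DihedralGroup 7) θ →
        ∃ j : ℕ, 1 ≤ j ∧ j ≤ 3 ∧ charInner (DihedralGroup 7) (F a b c ^ j) θ ≠ 0) ∧
      ¬ (∀ θ : DihedralGroup 7 → ℂ, IsIrredChar (DihedralGroup 7) θ →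
        ∃ j : ℕ, 1 ≤ j ∧ j ≤ 2 ∧ charInner (DihedralGroup 7) (F a b c ^ j) θ ≠ 0)) := by
  obtain ⟨a3, a5, a6⟩ := pow_rel h
  obtain ⟨b3, b5, b6⟩ := pow_rel h.rot
  obtain ⟨c3, c5, c6⟩ := pow_rel h.rot.rot
  have hE := fun s j hj => inner_E (F a b c) a b c s j hj rfl
  have i1 := fun j => inner_F a b c a b c h j
  have i2 := fun j => inner_F a b c b c a h.rot j
  have i3 := fun j => inner_F a b c c a b h.rot.rot j
  obtain ⟨g1, g2, g3, g4, g5, g6, g7, -, -, -⟩ := id h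
  have ne : ∀ x y : ℂ, x = y → y ≠ 0 → x ≠ 0 := fun x y h h' => h ▸ h'
  refine ⟨⟨?_, ?_⟩, ?_, ?_⟩
  · intro θ hθ
    rcases classify h h1 h2 h3 θ hθ with rfl | rfl | rfl | rfl | rfl
    · rw [hE _ _ (by norm_num)]
      refine ne _ 10 ?_ (by norm_num)
      rw [a6, b6, c6]; grind
    · rw [hE _ _ (by norm_num)]
      refine ne _ 10 ?_ (by norm_num)
      rw [a6, b6, c6]; grind
    · rw [i1]
      refine ne _ 1 ?_ (by norm_num)
      rw [a6, b6, c6]; grind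
    · rw [i2]
      refine ne _ 15 ?_ (by norm_num)
      rw [a6, b6, c6]; grind
    · rw [i3]
      refine ne _ 6 ?_ (by norm_num)
      rw [a6, b6, c6]; grind
  · intro H
    apply H _ (E_irr 1 (by norm_num))
    rw [hE _ _ (by norm_num), a5, b5, c5]
    grind
  · intro θ hθ
    rcases classify h h1 h2 h3 θ hθ with rfl | rfl | rfl | rfl | rfl
    · refine ⟨2, by norm_num, by norm_num, ?_⟩
      rw [hE _ _ (by norm_num)]
      refine ne _ 1 ?_ (by norm_num)
      grind
    · refine ⟨2, by norm_num, by norm_num, ?_⟩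
      rw [hE _ _ (by norm_num)]
      refine ne _ 1 ?_ (by norm_num)
      grind
    · refine ⟨1, by norm_num, by norm_num, ?_⟩
      rw [i1]
      refine ne _ 1 ?_ (by norm_num)
      grind
    · refine ⟨2, by norm_num, by norm_num, ?_⟩
      rw [i2]
      refine ne _ 1 ?_ (by norm_num)
      grind
    · refine ⟨3, by norm_num, by norm_num, ?_⟩
      rw [i3]
      refine ne _ 1 ?_ (by norm_num)
      rw [a3, b3, c3]; grind
  · intro H
    obtain ⟨j, hj1, hj2, hj⟩ := H _ h3
    apply hj
    rw [i3]
    interval_cases j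
    · grind
    · grind

/-- For the dihedral group of order 14 and any irreducible character `χ` with `χ(1) > 1`:
`e(χ) = 6` and `d(χ) = 3`. -/
theorem dihedral14_covering_numbers
    (χ : DihedralGroup 7 → ℂ) (hχ : IsIrredChar (DihedralGroup 7) χ) (hd : 1 < χ 1) :
    ((∀ θ : DihedralGroup 7 → ℂ, IsIrredChar (DihedralGroup 7) θ →
        charInner (DihedralGroup 7) (χ ^ 6) θ ≠ 0) ∧
      ¬ (∀ θ : DihedralGroup 7 → ℂ, IsIrredChar (DihedralGroup 7) θ →
        charInner (DihedralGroup 7) (χ ^ 5) θ ≠ 0)) ∧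
    ((∀ θ : DihedralGroup 7 → ℂ, IsIrredChar (DihedralGroup 7) θ →
        ∃ j : ℕ, 1 ≤ j ∧ j ≤ 3 ∧ charInner (DihedralGroup 7) (χ ^ j) θ ≠ 0) ∧
      ¬ (∀ θ : DihedralGroup 7 → ℂ, IsIrredChar (DihedralGroup 7) θ →
        ∃ j : ℕ, 1 ≤ j ∧ j ≤ 2 ∧ charInner (DihedralGroup 7) (χ ^ j) θ ≠ 0)) := by
  obtain ⟨a, b, c, h, h1, h2, h3⟩ := exists_abc
  rcases classify h h1 h2 h3 χ hχ with rfl | rfl | rfl | rfl | rfl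
  · exact absurd hd (lt_irrefl _)
  · exact absurd hd (lt_irrefl _)
  · exact main_aux h h1 h2 h3
  · exact main_aux h.rot h2 h3 h1
  · exact main_aux h.rot.rot h3 h1 h2
end
end
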